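/- Let X be a C_b^∞-vector field on ℝ^d and let γ ∈ (0,1]. Then there exists c > 0 such that ‖φ‖_{2;X,γ} ≤ c ‖φ‖_{2;γ} for all φ ∈ C_c^∞(ℝ^d). -/

import Mathlib

open MeasureTheory Complex Real Finset

noncomputable section

/-- Euclidean space `ℝ^d`. -/
abbrev Ec (d : ℕ) := EuclideanSpace ℝ (Fin d)

variable {d : ℕ}

/-- The `L²` norm of a complex-valued function. -/
def l2norm (f : Ec d → ℂ) : ℝ := (∫ x, ‖f x‖ ^ 2).sqrt

/-- Smooth compactly supported test functions. -/
def IsCc (φ : Ec d → ℂ) : Prop := ContDiff ℝ (⊤ : ℕ∞) φ ∧ HasCompactSupport φ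

/-- A `C_b^∞`-vector field on `ℝ^d`: a smooth coefficient map `a : ℝ^d → ℝ^d` which is
bounded together with all its derivatives. -/
def IsCbVF (a : Ec d → Ec d) : Prop :=
  ContDiff ℝ (⊤ : ℕ∞) a ∧ ∀ n : ℕ, ∃ C : ℝ, ∀ x, ‖iteratedFDeriv ℝ n a x‖ ≤ C

/-- `f` is the (smooth, globally defined) flow `f t x = exp(tX)(x)` of the vector field
with coefficient map `a`:  `f 0 x = x` and `∂_t f t x = a (f t x)`. -/
def IsFlowOf (a : Ec d → Ec d) (f : ℝ → Ec d → Ec d) : Prop :=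
  ContDiff ℝ (⊤ : ℕ∞) (fun p : ℝ × Ec d => f p.1 p.2) ∧
    (∀ x, f 0 x = x) ∧
    ∀ t x, HasDerivAt (fun s => f s x) (a (f t x)) t

/-- The Hölder norm `‖φ‖_{2;X,γ} = ‖φ‖₂ + sup_{0<|t|≤1} |t|^{-γ} ‖e^{tX}φ - φ‖₂`
associated with the flow `f` of a vector field `X`. -/
def vfHolder (f : ℝ → Ec d → Ec d) (γ : ℝ) (φ : Ec d → ℂ) : ℝ :=
  l2norm φ +
    sSup ((fun t : ℝ => |t| ^ (-γ) * l2norm fun x => φ (f t x) - φ x) ''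
      {t : ℝ | 0 < |t| ∧ |t| ≤ 1})

/-- The universal Hölder norm
`‖φ‖_{2;γ} = ‖φ‖₂ + sup_{0<|z|≤1} |z|^{-γ} ‖φ(· - z) - φ‖₂`. -/
def uHolder (γ : ℝ) (φ : Ec d → ℂ) : ℝ :=
  l2norm φ +
    sSup ((fun z : Ec d => ‖z‖ ^ (-γ) * l2norm fun x => φ (x - z) - φ x) ''
      {z : Ec d | 0 < ‖z‖ ∧ ‖z‖ ≤ 1})

lemma l2norm_nonneg (f : Ec d → ℂ) : 0 ≤ l2norm f := Real.sqrt_nonneg _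

lemma l2norm_le_of_lintegral_le {f : Ec d → ℂ} (hf : Continuous f) {b : ℝ} (hb : 0 ≤ b)
    (h : ∫⁻ x, ENNReal.ofReal (‖f x‖ ^ 2) ≤ ENNReal.ofReal (b ^ 2)) : l2norm f ≤ b := by
  unfold l2norm
  rw [integral_eq_lintegral_of_nonneg_ae (Filter.Eventually.of_forall fun x => by positivity)
    (by fun_prop)]
  exact Real.sqrt_le_iff.2 ⟨hb, ENNReal.toReal_le_of_le_ofReal (by positivity) h⟩

lemma lintegral_norm_sq_eq {f : Ec d → ℂ} (hf : Continuous f) (hc : HasCompactSupport f) :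
    ∫⁻ x, ENNReal.ofReal (‖f x‖ ^ 2) = ENNReal.ofReal (l2norm f ^ 2) := by
  have hint : Integrable fun x => ‖f x‖ ^ 2 :=
    Continuous.integrable_of_hasCompactSupport (by fun_prop)
      (hc.norm.comp_left (g := fun y : ℝ => y ^ 2) (by simp))
  unfold l2norm
  rw [Real.sq_sqrt (integral_nonneg fun x => by positivity),
    ofReal_integral_eq_lintegral_ofReal hint (Filter.Eventually.of_forall fun x => by positivity)]

lemma ofReal_norm_sub_sq_le (a b c : ℂ) :
    ENNReal.ofReal (‖a - c‖ ^ 2) ≤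
      2 * (ENNReal.ofReal (‖a - b‖ ^ 2) + ENNReal.ofReal (‖b - c‖ ^ 2)) := by
  rw [← ENNReal.ofReal_add (by positivity) (by positivity), ← ENNReal.ofReal_ofNat,
    ← ENNReal.ofReal_mul (by norm_num)]
  apply ENNReal.ofReal_le_ofReal
  have h : ‖a - c‖ ≤ ‖a - b‖ + ‖b - c‖ := norm_sub_le_norm_sub_add_norm_sub a b c
  nlinarith [norm_nonneg (a - c), sq_nonneg (‖a - b‖ - ‖b - c‖)]

lemma IsCc.continuous {φ : Ec d → ℂ} (hφ : IsCc φ) : Continuous φ := hφ.1.continuous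

/-- The `L²` modulus of continuity of a test function is at most linear. -/
lemma IsCc.exists_l2norm_translate_le {φ : Ec d → ℂ} (hφ : IsCc φ) :
    ∃ C : ℝ, 0 ≤ C ∧ ∀ z : Ec d, ‖z‖ ≤ 1 → l2norm (fun x => φ (x - z) - φ x) ≤ C * ‖z‖ := by
  obtain ⟨L, hL⟩ := hφ.1.lipschitzWith_of_hasCompactSupport hφ.2 (by simp)
  obtain ⟨R, hR⟩ := hφ.2.isCompact.isBounded.subset_closedBall (0 : Ec d)
  have hzero : ∀ x, R < ‖x‖ → φ x = 0 := fun x hx => by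
    by_contra h
    have := hR (subset_tsupport φ (Function.mem_support.2 h))
    rw [mem_closedBall_zero_iff] at this
    linarith
  have hc := hφ.continuous
  set v : ENNReal := volume (Metric.closedBall (0 : Ec d) (R + 1))
  have hv_top : v ≠ ⊤ := (isCompact_closedBall _ _).measure_lt_top.ne
  refine ⟨L * √v.toReal, by positivity, fun z hz => ?_⟩
  refine l2norm_le_of_lintegral_le (by fun_prop) (by positivity) ?_
  calc ∫⁻ x, ENNReal.ofReal (‖φ (x - z) - φ x‖ ^ 2)
      ≤ ∫⁻ x, (Metric.closedBall (0 : Ec d) (R + 1)).indicator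
          (fun _ => ENNReal.ofReal ((L * ‖z‖) ^ 2)) x := by
        refine lintegral_mono fun x => ?_
        by_cases hx : x ∈ Metric.closedBall (0 : Ec d) (R + 1)
        · rw [Set.indicator_of_mem hx]
          apply ENNReal.ofReal_le_ofReal
          gcongr
          have := hL.dist_le_mul (x - z) x
          rwa [dist_eq_norm, dist_eq_norm, sub_sub_cancel_left, norm_neg] at this
        · rw [mem_closedBall_zero_iff, not_le] at hx
          have h1 : φ x = 0 := hzero x (by linarith)
          have h2 : φ (x - z) = 0 := hzero _ (by linarith [norm_sub_norm_le x z])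
          simp [h1, h2]
    _ = ENNReal.ofReal ((L * ‖z‖) ^ 2) * v := by
        rw [lintegral_indicator_const Metric.isClosed_closedBall.measurableSet]
    _ = ENNReal.ofReal ((L * √v.toReal * ‖z‖) ^ 2) := by
        nth_rw 1 [← ENNReal.ofReal_toReal hv_top]
        rw [← ENNReal.ofReal_mul (by positivity), mul_pow, mul_pow, mul_pow,
          Real.sq_sqrt ENNReal.toReal_nonneg]
        ring_nf

lemma l2norm_le_uHolder (γ : ℝ) (φ : Ec d → ℂ) : l2norm φ ≤ uHolder γ φ := by
  refine le_add_of_nonneg_right (Real.sSup_nonneg ?_)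
  rintro _ ⟨z, -, rfl⟩
  exact mul_nonneg (by positivity) (l2norm_nonneg _)

lemma uHolder_nonneg (γ : ℝ) (φ : Ec d → ℂ) : 0 ≤ uHolder γ φ :=
  (l2norm_nonneg φ).trans (l2norm_le_uHolder γ φ)

lemma l2norm_translate_le_rpow {φ : Ec d → ℂ} (hφ : IsCc φ) {γ : ℝ} (hγ1 : γ ≤ 1)
    {z : Ec d} (hz0 : 0 < ‖z‖) (hz1 : ‖z‖ ≤ 1) :
    l2norm (fun x => φ (x - z) - φ x) ≤ ‖z‖ ^ γ * uHolder γ φ := by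
  obtain ⟨C, hC0, hC⟩ := hφ.exists_l2norm_translate_le
  have hbdd : BddAbove ((fun z : Ec d => ‖z‖ ^ (-γ) * l2norm fun x => φ (x - z) - φ x) ''
      {z : Ec d | 0 < ‖z‖ ∧ ‖z‖ ≤ 1}) := by
    refine ⟨C, ?_⟩
    rintro _ ⟨w, ⟨hw0, hw1⟩, rfl⟩
    calc ‖w‖ ^ (-γ) * l2norm (fun x => φ (x - w) - φ x)
        ≤ ‖w‖ ^ (-γ) * (C * ‖w‖) := by gcongr; exact hC w hw1
      _ = C * ‖w‖ ^ (1 - γ) := by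
          rw [sub_eq_neg_add, Real.rpow_add hw0, Real.rpow_one]; ring
      _ ≤ C := mul_le_of_le_one_right hC0
          (Real.rpow_le_one hw0.le hw1 (by linarith))
  have h := (le_csSup hbdd ⟨z, ⟨hz0, hz1⟩, rfl⟩).trans
    (le_add_of_nonneg_left (l2norm_nonneg φ) : _ ≤ uHolder γ φ)
  have hpos : 0 < ‖z‖ ^ γ := Real.rpow_pos_of_pos hz0 γ
  dsimp only at h
  rwa [Real.rpow_neg hz0.le, inv_mul_le_iff₀ hpos] at h

/-- Translations of arbitrary size are controlled by the universal Hölder norm. -/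
lemma lintegral_translate_le {φ : Ec d → ℂ} (hφ : IsCc φ) {γ : ℝ} (hγ0 : 0 < γ) (hγ1 : γ ≤ 1)
    (w : Ec d) :
    ∫⁻ x, ENNReal.ofReal (‖φ (x + w) - φ x‖ ^ 2) ≤
      ENNReal.ofReal (4 * (‖w‖ ^ γ * uHolder γ φ) ^ 2) := by
  have hN := uHolder_nonneg γ φ
  have hc := hφ.continuous
  rcases (norm_nonneg w).eq_or_lt with h0 | h0
  · simp [norm_eq_zero.1 h0.symm]
  rcases le_or_gt ‖w‖ 1 with h1 | h1
  · have hcs : HasCompactSupport fun x => φ (x + w) - φ x :=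
      (hφ.2.comp_homeomorph (Homeomorph.addRight w)).sub hφ.2
    rw [lintegral_norm_sq_eq (by fun_prop) hcs]
    apply ENNReal.ofReal_le_ofReal
    have h := l2norm_translate_le_rpow hφ hγ1 (z := -w) (by simpa using h0) (by simpa using h1)
    simp only [sub_neg_eq_add, norm_neg] at h
    have := pow_le_pow_left₀ (l2norm_nonneg _) h 2
    nlinarith [sq_nonneg (‖w‖ ^ γ * uHolder γ φ)]
  · have hw : 1 ≤ ‖w‖ ^ γ := Real.one_le_rpow h1.le hγ0.le
    calc ∫⁻ x, ENNReal.ofReal (‖φ (x + w) - φ x‖ ^ 2)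
        ≤ ∫⁻ x, 2 * (ENNReal.ofReal (‖φ (x + w)‖ ^ 2) + ENNReal.ofReal (‖φ x‖ ^ 2)) :=
          lintegral_mono fun x => by simpa using ofReal_norm_sub_sq_le (φ (x + w)) 0 (φ x)
      _ = 2 * (ENNReal.ofReal (l2norm φ ^ 2) + ENNReal.ofReal (l2norm φ ^ 2)) := by
          rw [lintegral_const_mul _ (by fun_prop), lintegral_add_right _ (by fun_prop),
            lintegral_add_right_eq_self (fun x => ENNReal.ofReal (‖φ x‖ ^ 2)) w,
            lintegral_norm_sq_eq hc hφ.2]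
      _ = ENNReal.ofReal (4 * l2norm φ ^ 2) := by
          rw [← ENNReal.ofReal_add (by positivity) (by positivity), ← ENNReal.ofReal_ofNat 2,
            ← ENNReal.ofReal_mul (by norm_num)]
          ring_nf
      _ ≤ _ := by
          apply ENNReal.ofReal_le_ofReal
          have h := l2norm_nonneg φ
          gcongr
          calc l2norm φ ≤ 1 * uHolder γ φ := by rw [one_mul]; exact l2norm_le_uHolder γ φ
            _ ≤ _ := by gcongr

lemma IsCbVF.exists_norm_le {a : Ec d → Ec d} (ha : IsCbVF a) :
    ∃ M : ℝ, 0 ≤ M ∧ ∀ x, ‖a x‖ ≤ M := by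
  obtain ⟨M, hM⟩ := ha.2 0
  simp only [norm_iteratedFDeriv_zero] at hM
  exact ⟨M, (norm_nonneg _).trans (hM 0), hM⟩

lemma IsCbVF.exists_lipschitzWith {a : Ec d → Ec d} (ha : IsCbVF a) :
    ∃ L : NNReal, LipschitzWith L a := by
  obtain ⟨L, hL⟩ := ha.2 1
  simp only [norm_iteratedFDeriv_one] at hL
  refine ⟨⟨L, (norm_nonneg _).trans (hL 0)⟩, lipschitzWith_of_nnnorm_fderiv_le
    (ha.1.differentiable (by simp)) fun x => hL x⟩

lemma IsFlowOf.norm_sub_le {a : Ec d → Ec d} {f : ℝ → Ec d → Ec d} (hf : IsFlowOf a f)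
    {M : ℝ} (hM : ∀ x, ‖a x‖ ≤ M) (t : ℝ) (x : Ec d) : ‖f t x - x‖ ≤ M * |t| := by
  have := convex_univ.norm_image_sub_le_of_norm_hasDerivWithin_le
    (f := fun s => f s x) (fun s _ => (hf.2.2 s x).hasDerivWithinAt) (fun s _ => hM _)
    (Set.mem_univ 0) (Set.mem_univ t)
  simpa [hf.2.1] using this

/-- Grönwall's inequality along the trajectories run backwards to time `0`. -/
lemma IsFlowOf.antilipschitzWith {a : Ec d → Ec d} {f : ℝ → Ec d → Ec d} (hf : IsFlowOf a f)
    {L : NNReal} (hL : LipschitzWith L a) (t : ℝ) :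
    AntilipschitzWith (Real.exp (L * |t|)).toNNReal (f t) := by
  obtain ⟨σ, hσ, hσt⟩ : ∃ σ : ℝ, |σ| = 1 ∧ σ * |t| = t := by
    rcases le_total 0 t with h | h
    · exact ⟨1, by simp, by simp [abs_of_nonneg h]⟩
    · exact ⟨-1, by simp, by simp [abs_of_nonpos h]⟩
  have hderiv : ∀ x s, HasDerivAt (fun s => f (t - σ * s) x) ((-σ) • a (f (t - σ * s) x)) s :=
    fun x s => HasDerivAt.scomp (g₁ := fun r => f r x) (h := fun s => t - σ * s) s
      (hf.2.2 (t - σ * s) x) (by simpa using ((hasDerivAt_id s).const_mul σ).const_sub t)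
  have hlip : LipschitzWith L fun y => (-σ) • a y := by
    refine LipschitzWith.of_dist_le_mul fun x y => ?_
    rw [dist_smul₀, norm_neg, Real.norm_eq_abs, hσ, one_mul]
    exact hL.dist_le_mul x y
  refine AntilipschitzWith.of_le_mul_dist fun x y => ?_
  have h := dist_le_of_trajectories_ODE (v := fun _ y => (-σ) • a y) (K := L)
    (f := fun s => f (t - σ * s) x) (g := fun s => f (t - σ * s) y) (a := 0) (b := |t|)
    (δ := dist (f t x) (f t y)) (fun _ => hlip)
    (fun s _ => (hderiv x s).continuousAt.continuousWithinAt)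
    (fun s _ => (hderiv x s).hasDerivWithinAt)
    (fun s _ => (hderiv y s).continuousAt.continuousWithinAt)
    (fun s _ => (hderiv y s).hasDerivWithinAt) (by simp) |t| ⟨abs_nonneg t, le_rfl⟩
  simp only [hσt, sub_self, hf.2.1, sub_zero] at h
  rw [Real.coe_toNNReal _ (Real.exp_pos _).le, mul_comm]
  exact h

lemma AntilipschitzWith.volume_preimage_le {g : Ec d → Ec d} {K : NNReal}
    (hg : AntilipschitzWith K g) (s : Set (Ec d)) :
    volume (g ⁻¹' s) ≤ (K : ENNReal) ^ d * volume s := by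
  have : (Measure.hausdorffMeasure d : Measure (Ec d)).IsAddHaarMeasure := by
    simpa using isAddHaarMeasure_hausdorffMeasure (E := Ec d)
  rw [Measure.isAddLeftInvariant_eq_smul (volume : Measure (Ec d)) (Measure.hausdorffMeasure d)]
  simp only [Measure.smul_apply, ENNReal.smul_def, smul_eq_mul]
  rw [mul_left_comm]
  gcongr
  simpa using hg.hausdorffMeasure_preimage_le (Nat.cast_nonneg d) s

lemma AntilipschitzWith.lintegral_comp_le {g : Ec d → Ec d} {K : NNReal}
    (hg : AntilipschitzWith K g) (hgm : Measurable g) {h : Ec d → ENNReal} (hh : Measurable h) :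
    ∫⁻ x, h (g x) ≤ (K : ENNReal) ^ d * ∫⁻ x, h x := by
  rw [← lintegral_map hh hgm, ← smul_eq_mul, ← lintegral_smul_measure]
  refine lintegral_mono' (Measure.le_iff.2 fun s hs => ?_) le_rfl
  rw [Measure.map_apply hgm hs]
  exact hg.volume_preimage_le s

/-- If `g` moves points by at most `(R - 1) r` and contracts volume boundedly, then
`‖φ ∘ g - φ‖₂` is controlled by the translations of size at most `R r`. -/
lemma lintegral_comp_sub_le {g : Ec d → Ec d} {K : NNReal} (hg : AntilipschitzWith K g)
    (hgc : Continuous g) {r R : ℝ} (hr : 0 < r) (hR : 1 ≤ R)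
    (hgr : ∀ x, ‖g x - x‖ ≤ (R - 1) * r) {φ : Ec d → ℂ} (hφ : Continuous φ) {A : ENNReal}
    (hA : ∀ w : Ec d, ‖w‖ ≤ R * r → ∫⁻ x, ENNReal.ofReal (‖φ (x + w) - φ x‖ ^ 2) ≤ A) :
    ∫⁻ x, ENNReal.ofReal (‖φ (g x) - φ x‖ ^ 2) ≤
      2 * ((K : ENNReal) ^ d + ENNReal.ofReal (R ^ d)) * A := by
  set B := Metric.ball (0 : Ec d) r
  set B' := Metric.ball (0 : Ec d) (R * r) with hB'
  have hBm : MeasurableSet B := measurableSet_ball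
  have hB'm : MeasurableSet B' := measurableSet_ball
  have hB0 : volume B ≠ 0 := (Metric.measure_ball_pos _ _ hr).ne'
  have hBtop : volume B ≠ ⊤ := measure_ball_lt_top.ne
  have hvol : volume B' = ENNReal.ofReal (R ^ d) * volume B := by
    rw [hB', Measure.addHaar_ball_mul_of_pos _ _ (by linarith), finrank_euclideanSpace_fin]
  have hfar : ∫⁻ z in B, ∫⁻ x, ENNReal.ofReal (‖φ (g x) - φ (g x + z)‖ ^ 2) ≤
      (K : ENNReal) ^ d * A * volume B := by
    calc _ ≤ ∫⁻ z in B, (K : ENNReal) ^ d * A := by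
          refine setLIntegral_mono' hBm fun z hz => ?_
          refine (hg.lintegral_comp_le hgc.measurable
            (h := fun y => ENNReal.ofReal (‖φ y - φ (y + z)‖ ^ 2)) (by fun_prop)).trans ?_
          gcongr
          simp_rw [norm_sub_rev (φ _) (φ (_ + z))]
          refine hA z ((mem_ball_zero_iff.1 hz).le.trans ?_)
          nlinarith
      _ = _ := setLIntegral_const _ _
  have hnear : ∫⁻ x, ∫⁻ z in B, ENNReal.ofReal (‖φ (g x + z) - φ x‖ ^ 2) ≤
      A * (ENNReal.ofReal (R ^ d) * volume B) := by
    calc _ ≤ ∫⁻ x, ∫⁻ w in B', ENNReal.ofReal (‖φ (x + w) - φ x‖ ^ 2) := by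
          refine lintegral_mono fun x => ?_
          rw [← lintegral_indicator hBm, ← lintegral_indicator hB'm,
            ← lintegral_add_right_eq_self (B'.indicator _) (g x - x)]
          refine lintegral_mono fun z => ?_
          by_cases hz : z ∈ B
          · have hz' : z + (g x - x) ∈ B' := by
              rw [hB', mem_ball_zero_iff]
              have := norm_add_le z (g x - x)
              have := mem_ball_zero_iff.1 hz
              nlinarith [hgr x]
            rw [Set.indicator_of_mem hz, Set.indicator_of_mem hz']
            rw [show x + (z + (g x - x)) = g x + z by abel]
          · simp [Set.indicator_of_notMem hz]
      _ = ∫⁻ w in B', ∫⁻ x, ENNReal.ofReal (‖φ (x + w) - φ x‖ ^ 2) :=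
          lintegral_lintegral_swap (by
            apply Measurable.aemeasurable
            unfold Function.uncurry
            fun_prop)
      _ ≤ ∫⁻ w in B', A := setLIntegral_mono' hB'm fun w hw => hA w (mem_ball_zero_iff.1 hw).le
      _ = _ := by rw [setLIntegral_const, hvol]
  have hmeas : Measurable fun x =>
      ∫⁻ z in B, ENNReal.ofReal (‖φ (g x) - φ (g x + z)‖ ^ 2) :=
    Measurable.lintegral_prod_right'
      (f := fun p : Ec d × Ec d => ENNReal.ofReal (‖φ (g p.1) - φ (g p.1 + p.2)‖ ^ 2))
      (by fun_prop)
  rw [← ENNReal.mul_le_mul_iff_left hB0 hBtop]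
  calc (∫⁻ x, ENNReal.ofReal (‖φ (g x) - φ x‖ ^ 2)) * volume B
      = ∫⁻ x, ∫⁻ z in B, ENNReal.ofReal (‖φ (g x) - φ x‖ ^ 2) := by
        simp_rw [setLIntegral_const]
        rw [lintegral_mul_const _ (by fun_prop)]
    _ ≤ ∫⁻ x, ∫⁻ z in B, 2 * (ENNReal.ofReal (‖φ (g x) - φ (g x + z)‖ ^ 2) +
          ENNReal.ofReal (‖φ (g x + z) - φ x‖ ^ 2)) :=
        lintegral_mono fun x => lintegral_mono fun z => ofReal_norm_sub_sq_le _ _ _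
    _ = 2 * ((∫⁻ x, ∫⁻ z in B, ENNReal.ofReal (‖φ (g x) - φ (g x + z)‖ ^ 2)) +
          ∫⁻ x, ∫⁻ z in B, ENNReal.ofReal (‖φ (g x + z) - φ x‖ ^ 2)) := by
        rw [← lintegral_add_left hmeas, ← lintegral_const_mul' _ _ (by simp)]
        refine lintegral_congr fun x => ?_
        rw [← lintegral_add_left (by fun_prop), ← lintegral_const_mul' _ _ (by simp)]
    _ ≤ 2 * ((K : ENNReal) ^ d * A * volume B + A * (ENNReal.ofReal (R ^ d) * volume B)) := by
        rw [lintegral_lintegral_swap (by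
            apply Measurable.aemeasurable
            unfold Function.uncurry
            fun_prop)]
        gcongr
    _ = _ := by ring

/-- **Corollary 4.3 of ter Elst–Robinson, "Uniform subellipticity".**
Let `X` be a `C_b^∞`-vector field on `ℝ^d` and `γ ∈ (0,1]`.  Then there is a `c > 0`
such that `‖φ‖_{2;X,γ} ≤ c ‖φ‖_{2;γ}` for all `φ ∈ C_c^∞(ℝ^d)`. -/
theorem holder_norm_le_universal (d : ℕ) (a : Ec d → Ec d) (ha : IsCbVF a)
    (f : ℝ → Ec d → Ec d) (hf : IsFlowOf a f)
    (γ : ℝ) (hγ0 : 0 < γ) (hγ1 : γ ≤ 1) :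
    ∃ c : ℝ, 0 < c ∧ ∀ φ : Ec d → ℂ, IsCc φ →
      vfHolder f γ φ ≤ c * uHolder γ φ := by
  obtain ⟨M, hM0, hM⟩ := ha.exists_norm_le
  obtain ⟨L, hL⟩ := ha.exists_lipschitzWith
  set K : NNReal := (Real.exp L).toNNReal
  set D : ℝ := 8 * (K ^ d + (M + 1) ^ d) with hD
  have hD0 : 0 ≤ D := by positivity
  refine ⟨1 + √D * (M + 1), by positivity, fun φ hφ => ?_⟩
  have hc := hφ.continuous
  have hN := uHolder_nonneg γ φ
  set N := uHolder γ φ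
  have hsup : sSup ((fun t : ℝ => |t| ^ (-γ) * l2norm fun x => φ (f t x) - φ x) ''
      {t : ℝ | 0 < |t| ∧ |t| ≤ 1}) ≤ √D * (M + 1) * N := by
    refine Real.sSup_le ?_ (by positivity)
    rintro _ ⟨t, ⟨ht0, ht1⟩, rfl⟩
    have hfc : Continuous (f t) :=
      hf.1.continuous.comp (Continuous.prodMk continuous_const continuous_id)
    have hanti : AntilipschitzWith K (f t) := by
      refine fun x y => (hf.antilipschitzWith hL t x y).trans ?_
      gcongr
      exact Real.toNNReal_le_toNNReal (Real.exp_le_exp.2 (mul_le_of_le_one_right L.2 ht1))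
    have hrpow : ((M + 1) * |t|) ^ γ ≤ (M + 1) * |t| ^ γ := by
      rw [Real.mul_rpow (by positivity) (by positivity)]
      gcongr
      exact Real.rpow_le_self_of_one_le (by linarith) hγ1
    have hpos : 0 < |t| ^ γ := Real.rpow_pos_of_pos ht0 γ
    dsimp only
    rw [Real.rpow_neg ht0.le, inv_mul_le_iff₀ hpos]
    refine l2norm_le_of_lintegral_le (by fun_prop) (by positivity) ?_
    refine (lintegral_comp_sub_le hanti hfc ht0 (R := M + 1) (by linarith)
      (fun x => by simpa using hf.norm_sub_le hM t x) hc
      (A := ENNReal.ofReal (4 * ((M + 1) * |t| ^ γ * N) ^ 2)) fun w hw => ?_).trans_eq ?_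
    · refine (lintegral_translate_le hφ hγ0 hγ1 w).trans (ENNReal.ofReal_le_ofReal ?_)
      gcongr
      exact (Real.rpow_le_rpow (norm_nonneg w) hw hγ0.le).trans hrpow
    · rw [← ENNReal.ofReal_coe_nnreal, ← ENNReal.ofReal_pow K.coe_nonneg,
        ← ENNReal.ofReal_add (by positivity) (by positivity), ← ENNReal.ofReal_ofNat 2,
        ← ENNReal.ofReal_mul (by norm_num), ← ENNReal.ofReal_mul (by positivity)]
      congr 1
      simp only [mul_pow, Real.sq_sqrt hD0]
      rw [hD]
      ring
  have := l2norm_le_uHolder γ φ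
  unfold vfHolder
  linarith

end
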